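/- There exist computable functions V : ℕ → ℕ → Bool and e : ℕ → ℕ → ℕ × ℕ such that, writing V_n = {x ∈ ℕ : V n x = true} and letting τ be the topology on ℕ generated by the sets V_n: (i) (effectively Hausdorff) for all distinct x, y ∈ ℕ, if e x y = (m, n) then x ∈ V_m, y ∈ V_n, and V_m ∩ V_n = ∅; (ii) (discrete) every singleton {x} is τ-open; and yet (iii) there is no infinite computable set Y ⊆ ℕ together with a computable function d : ℕ → List ℕ such that for every x ∈ Y, d x is nonempty and (⋂_{i ∈ d x} V_i) ∩ Y = {x}. In other words, there is an infinite computable effectively Hausdorff CSC space which is discrete but has no infinite computable effectively discrete subspace. -/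

import Mathlib

/-- The topology on ℕ generated by a computably presented countable family of basic sets
`V n = {x | V n x = true}` (a CSC space presentation). -/
def cscTop (V : ℕ → ℕ → Bool) : TopologicalSpace ℕ :=
  TopologicalSpace.generateFrom {s | ∃ n : ℕ, s = {x | V n x = true}}

namespace FiniteInjury

open Nat.Partrec (Code)

/-- `s = ⟨x, w⟩` is eligible for requirement `k` above the restraint `t`: `W k s` holds and the
point `x` is at least `k` and `t`. -/
def eligible (W : ℕ → ℕ → Bool) (k t s : ℕ) : Bool :=
  decide (k ≤ s.unpair.1 ∧ t ≤ s.unpair.1 ∧ s.unpair.1 < s) && W k s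

/-- The first `s ≤ z` eligible for requirement `k` above `t`, or `t` if there is none. -/
def next (W : ℕ → ℕ → Bool) (z k t : ℕ) : ℕ :=
  if (List.range (z + 1)).findIdx (eligible W k t) ≤ z then
    (List.range (z + 1)).findIdx (eligible W k t) else t

/-- The restraint imposed by the requirements below `k`, as seen at stage `z`. -/
def restraint (W : ℕ → ℕ → Bool) (z : ℕ) : ℕ → ℕ
  | 0 => 0
  | k + 1 => next W z k (restraint W z k)

/-- The basic set with index `n = ⟨x, y⟩` contains `x` but not `y`. A further point `z` looks at
the restraint `r = ⟨x', w⟩` it sees, copies `x'` if `n < r`, and is left out otherwise. -/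
def basic (W : ℕ → ℕ → Bool) (n z : ℕ) : Bool :=
  if z = n.unpair.1 then true
  else if z = n.unpair.2 then false
  else if n < restraint W z z then
    if _h : (restraint W z z).unpair.1 < z then basic W n (restraint W z z).unpair.1 else false
  else false
termination_by z

variable {W : ℕ → ℕ → Bool}

theorem eligible_iff {k t s : ℕ} : eligible W k t s = true ↔
    k ≤ s.unpair.1 ∧ t ≤ s.unpair.1 ∧ s.unpair.1 < s ∧ W k s = true := by
  simp [eligible, and_assoc]

theorem next_spec (z k t : ℕ) :
    (next W z k t ≤ z ∧ eligible W k t (next W z k t) = true ∧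
      ∀ s < next W z k t, eligible W k t s = false) ∨
    (next W z k t = t ∧ ∀ s ≤ z, eligible W k t s = false) := by
  unfold next
  set i := (List.range (z + 1)).findIdx (eligible W k t) with hi
  split_ifs with h
  · left
    have hlt : (List.range (z + 1)).findIdx (eligible W k t) < (List.range (z + 1)).length := by
      simp; omega
    refine ⟨h, by simpa using List.findIdx_getElem (w := hlt), fun s hs => ?_⟩
    have := List.not_of_lt_findIdx (hi ▸ hs)
    rwa [List.getElem_range] at this
  · right
    refine ⟨rfl, fun s hs => ?_⟩
    have h' : (List.range (z + 1)).findIdx (eligible W k t) = (List.range (z + 1)).length := by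
      refine le_antisymm List.findIdx_le_length ?_
      rw [List.length_range, ← hi]
      omega
    exact List.findIdx_eq_length.1 h' s (by simp; omega)

theorem restraint_le (z k : ℕ) : restraint W z k ≤ z := by
  induction k with
  | zero => exact Nat.zero_le _
  | succ k ih =>
    rcases next_spec (W := W) z k (restraint W z k) with h | h
    · exact h.1
    · exact h.1.trans_le ih

theorem restraint_mono (z : ℕ) : Monotone (restraint W z) := by
  refine monotone_nat_of_le_succ fun k => ?_
  rcases next_spec (W := W) z k (restraint W z k) with h | h
  · obtain ⟨-, h₁, h₂, -⟩ := eligible_iff.1 h.2.1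
    exact h₁.trans h₂.le
  · exact h.1.ge

theorem next_eq {z z' k t : ℕ} (hz : z' ≤ z) (h : next W z k t ≤ z') :
    next W z' k t = next W z k t := by
  rcases next_spec (W := W) z k t with h₁ | h₁ <;> rcases next_spec (W := W) z' k t with h₂ | h₂
  · refine le_antisymm (not_lt.1 fun hlt => ?_) (not_lt.1 fun hlt => ?_)
    · simp [h₂.2.2 _ hlt] at h₁
    · simp [h₁.2.2 _ hlt] at h₂
  · simp [h₂.2 _ h] at h₁
  · simp [h₁.2 _ (h₂.1.trans hz)] at h₂
  · rw [h₁.1, h₂.1]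

theorem restraint_eq {z z' k : ℕ} (hz : z' ≤ z) (h : restraint W z k ≤ z') :
    restraint W z' k = restraint W z k := by
  induction k with
  | zero => rfl
  | succ k ih =>
    have hk := ih ((restraint_mono z k.le_succ).trans h)
    simp only [restraint, hk]
    exact next_eq hz h

/-- A restraint that grows between `j` and `k` was last raised by a requirement in between. -/
theorem restraint_eq_or_exists (z : ℕ) {j k : ℕ} (hjk : j ≤ k) :
    restraint W z k = restraint W z j ∨ ∃ i, j ≤ i ∧ i < k ∧
      restraint W z k = restraint W z (i + 1) ∧
      eligible W i (restraint W z i) (restraint W z k) = true := by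
  induction k, hjk using Nat.le_induction with
  | base => exact .inl rfl
  | succ k hjk ih =>
    rcases next_spec (W := W) z k (restraint W z k) with h | h
    · exact .inr ⟨k, hjk, k.lt_succ_self, rfl, h.2.1⟩
    · have hk : restraint W z (k + 1) = restraint W z k := h.1
      rw [hk]
      refine ih.imp_right ?_
      rintro ⟨i, hi⟩
      exact ⟨i, hi.1, hi.2.1.trans k.lt_succ_self, hi.2.2⟩

theorem unpair_restraint_lt {z k : ℕ} (h : restraint W z k ≠ 0) :
    (restraint W z k).unpair.1 < restraint W z k := by
  rcases restraint_eq_or_exists (W := W) z k.zero_le with h' | ⟨i, -, -, -, h'⟩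
  · exact absurd h' h
  · exact (eligible_iff.1 h').2.2.1

theorem exists_restraint_eventually_eq (k : ℕ) : ∃ T N, ∀ z ≥ N, restraint W z k = T := by
  induction k with
  | zero => exact ⟨0, 0, fun _ _ => rfl⟩
  | succ k ih =>
    obtain ⟨T, N, hT⟩ := ih
    by_cases h : ∃ z ≥ N, ∃ s ≤ z, eligible W k T s = true
    · obtain ⟨z, hz, s, hs, h⟩ := h
      refine ⟨next W z k T, z, fun z' hz' => ?_⟩
      simp only [restraint, hT z' (hz.trans hz')]
      rcases next_spec (W := W) z k T with h₁ | h₁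
      · rcases next_spec (W := W) z' k T with h₂ | h₂
        · refine (next_eq hz' ?_).symm
          refine le_trans (not_lt.1 fun hlt => ?_) hs
          simp [h₂.2.2 _ hlt] at h
        · simp [h₂.2 _ (h₁.1.trans hz')] at h₁
      · simp [h₁.2 _ hs] at h
    · push Not at h
      refine ⟨T, N, fun z hz => ?_⟩
      simp only [restraint, hT z hz]
      rcases next_spec (W := W) z k T with h₁ | h₁
      · exact absurd h₁.2.1 (h z hz _ h₁.1)
      · exact h₁.1

theorem exists_restraint_bound (k : ℕ) : ∃ B, ∀ z, ∀ j ≤ k, restraint W z j ≤ B := by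
  obtain ⟨T, N, hT⟩ := exists_restraint_eventually_eq (W := W) k
  refine ⟨max T N, fun z j hj => (restraint_mono z hj).trans ?_⟩
  rcases le_total N z with h | h
  · exact (hT z h).trans_le (le_max_left _ _)
  · exact ((restraint_le z k).trans h).trans (le_max_right _ _)

theorem basic_of_lt {n z : ℕ} (hn : n < restraint W z z) :
    basic W n z = basic W n (restraint W z z).unpair.1 := by
  have hz := restraint_le (W := W) z z
  have h₁ := n.unpair_left_le
  have h₂ := n.unpair_right_le
  have h := unpair_restraint_lt (W := W) (z := z) (k := z) (by omega)
  rw [basic, if_neg (by omega), if_neg (by omega), if_pos hn, dif_pos (by omega)]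

theorem basic_eq_false {n z : ℕ} (hz : z ≠ n.unpair.1) (hn : restraint W z z ≤ n) :
    basic W n z = false := by
  rw [basic, if_neg hz, if_neg (not_lt.2 hn), ite_self]

theorem basic_left (x y : ℕ) : basic W (Nat.pair x y) x = true := by
  rw [basic]; simp

theorem basic_right {x y : ℕ} (h : x ≠ y) : basic W (Nat.pair x y) y = false := by
  rw [basic]; simp [h.symm]

/-- Points copy the anchor of every restraint they see, not only of the last one. -/
theorem basic_eq_basic_restraint (z : ℕ) {j n : ℕ} (hj : j ≤ z) (hn : n < restraint W z j) :
    basic W n z = basic W n (restraint W z j).unpair.1 := by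
  induction z using Nat.strong_induction_on with
  | _ z ih =>
    have hlt : n < restraint W z z := hn.trans_le (restraint_mono z hj)
    rw [basic_of_lt hlt]
    rcases restraint_eq_or_exists (W := W) z hj with h | ⟨i, hji, -, -, h⟩
    · rw [h]
    · obtain ⟨h₁, h₂, h₃, -⟩ := eligible_iff.1 h
      have hz := h₃.trans_le (restraint_le z z)
      have hr := restraint_eq hz.le ((restraint_mono z hji).trans h₂)
      rw [ih _ hz (hji.trans h₁) (hr ▸ hn), hr]

theorem basic_disjoint {x y : ℕ} (hxy : x ≠ y) (z : ℕ) :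
    ¬ (basic W (Nat.pair x y) z = true ∧ basic W (Nat.pair y x) z = true) := by
  induction z using Nat.strong_induction_on with
  | _ z ih =>
    rintro ⟨h₁, h₂⟩
    have hx : z ≠ x := by rintro rfl; simp [basic_right hxy.symm] at h₂
    have hy : z ≠ y := by rintro rfl; simp [basic_right hxy] at h₁
    rcases le_or_gt (restraint W z z) (Nat.pair x y) with h | hlt
    · rw [basic_eq_false (by simpa using hx) h] at h₁; cases h₁
    rcases le_or_gt (restraint W z z) (Nat.pair y x) with h | hlt'
    · rw [basic_eq_false (by simpa using hy) h] at h₂; cases h₂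
    rw [basic_of_lt hlt] at h₁
    rw [basic_of_lt hlt'] at h₂
    exact ih _ ((unpair_restraint_lt (by omega)).trans_le (restraint_le z z)) ⟨h₁, h₂⟩

theorem exists_basic_eq_singleton (x : ℕ) : ∃ n, {x} = {z | basic W n z = true} := by
  obtain ⟨B, hB⟩ := exists_restraint_bound (W := W) (x + 1)
  have hn : B ≤ Nat.pair x (B + x + 1) := by
    have := Nat.right_le_pair x (B + x + 1)
    omega
  refine ⟨Nat.pair x (B + x + 1), Set.ext fun z => ⟨?_, ?_⟩⟩
  · rintro rfl
    exact basic_left _ _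
  · change basic W (Nat.pair x (B + x + 1)) z = true → z = x
    contrapose!
    induction z using Nat.strong_induction_on with
    | _ z ih =>
      intro hz
      rcases le_or_gt (restraint W z z) (Nat.pair x (B + x + 1)) with h | hlt
      · simp [basic_eq_false (n := Nat.pair x (B + x + 1)) (by simpa using hz) h]
      rw [basic_of_lt hlt]
      have hlt' := (unpair_restraint_lt (W := W) (z := z) (k := z) (by omega)).trans_le
        (restraint_le z z)
      refine ih _ hlt' fun hx => ?_
      rcases restraint_eq_or_exists (W := W) z z.zero_le with h | ⟨i, -, -, h, h'⟩
      · rw [h] at hlt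
        exact Nat.not_lt_zero _ hlt
      · have hi : i ≤ x := hx ▸ (eligible_iff.1 h').1
        have := hB z (i + 1) (by omega)
        omega

/-- Every requirement is met: if all points of the infinite set `Y` have witnesses for `k`, then
the point of some witness for `k` is copied by another point of `Y`. -/
theorem exists_copy {Y : Set ℕ} (hY : Y.Infinite) (k : ℕ)
    (hcomplete : ∀ x ∈ Y, ∃ s, s.unpair.1 = x ∧ x < s ∧ W k s = true) :
    ∃ s, W k s = true ∧ ∃ y ∈ Y, y ≠ s.unpair.1 ∧
      ∀ n < s, basic W n y = basic W n s.unpair.1 := by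
  obtain ⟨T, N, hT⟩ := exists_restraint_eventually_eq (W := W) k
  obtain ⟨x, hx, hxT⟩ := hY.exists_gt (max k T)
  obtain ⟨s, hs, hxs, hW⟩ := hcomplete x hx
  obtain ⟨y, hy, hylt⟩ := hY.exists_gt (max (max N s) (k + 1))
  simp only [max_lt_iff] at hxT hylt
  have hel : eligible W k T s = true := eligible_iff.2 ⟨by omega, by omega, by omega, hW⟩
  have hk := hT y hylt.1.1.le
  rcases next_spec (W := W) y k T with h | h
  · obtain ⟨-, -, h₁, h₂⟩ := eligible_iff.1 h.2.1
    have hr : restraint W y (k + 1) = next W y k T := by rw [restraint, hk]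
    refine ⟨next W y k T, h₂, y, hy, by omega, fun n hn => ?_⟩
    rw [← hr] at hn ⊢
    exact basic_eq_basic_restraint y hylt.2.le hn
  · simp [h.2 s (by omega)] at hel

theorem primrec_eligible (hW : Primrec₂ W) :
    Primrec₂ fun (a : ℕ × ℕ) (s : ℕ) => eligible W a.1 a.2 s := by
  have hl : Primrec fun p : (ℕ × ℕ) × ℕ => p.2.unpair.1 :=
    Primrec.fst.comp (Primrec.unpair.comp .snd)
  have hk : Primrec fun p : (ℕ × ℕ) × ℕ => p.1.1 := Primrec.fst.comp .fst
  have ht : Primrec fun p : (ℕ × ℕ) × ℕ => p.1.2 := Primrec.snd.comp .fst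
  exact Primrec.and.comp
    ((Primrec.nat_le.comp hk hl).and
      ((Primrec.nat_le.comp ht hl).and (Primrec.nat_lt.comp hl .snd))).decide
    (hW.comp hk .snd)

theorem primrec_restraint (hW : Primrec₂ W) : Primrec₂ (restraint W) := by
  have hnext : Primrec₂ fun (z : ℕ) (p : ℕ × ℕ) => next W z p.1 p.2 := by
    have hi : Primrec fun q : ℕ × ℕ × ℕ =>
        (List.range (q.1 + 1)).findIdx (eligible W q.2.1 q.2.2) :=
      Primrec.list_findIdx (Primrec.list_range.comp (Primrec.succ.comp .fst))
        ((primrec_eligible hW).comp (Primrec.snd.comp .fst) .snd)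
    exact Primrec.ite (Primrec.nat_le.comp hi .fst) hi (Primrec.snd.comp .snd)
  refine (Primrec.nat_rec (Primrec.const 0) hnext).of_eq fun z k => ?_
  induction k with
  | zero => rfl
  | succ k ih => simp only [restraint, ← ih]

theorem primrec_basic (hW : Primrec₂ W) : Primrec₂ (basic W) := by
  have hz : Primrec fun p : ℕ × List Bool => p.2.length := Primrec.list_length.comp .snd
  have hu : Primrec fun p : ℕ × List Bool => p.1.unpair := Primrec.unpair.comp .fst
  have hr : Primrec fun p : ℕ × List Bool => restraint W p.2.length p.2.length :=
    (primrec_restraint hW).comp hz hz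
  have hx := Primrec.fst.comp (Primrec.unpair.comp hr)
  have hg : Primrec₂ fun (n : ℕ) (l : List Bool) =>
      if l.length = n.unpair.1 then some true
      else if l.length = n.unpair.2 then some false
      else if n < restraint W l.length l.length then
        l[(restraint W l.length l.length).unpair.1]?
      else some false :=
    Primrec.ite (Primrec.eq.comp hz (Primrec.fst.comp hu)) (.const _) <|
      Primrec.ite (Primrec.eq.comp hz (Primrec.snd.comp hu)) (.const _) <|
        Primrec.ite (Primrec.nat_lt.comp .fst hr) (Primrec.list_getElem?.comp .snd hx) (.const _)
  refine Primrec.nat_strong_rec (basic W) hg fun n z => ?_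
  simp only [List.length_map, List.length_range]
  rw [basic]
  split_ifs with h₁ h₂ h₃ h₄
  · rfl
  · rfl
  · simp [h₄]
  · exact absurd ((unpair_restraint_lt (by omega)).trans_le (restraint_le z z)) h₄
  · rfl

/-- `k` codes a function which within `w` steps takes a value in `[1, s]` at `x`, where
`s = ⟨x, w⟩`. -/
def codeWitness (k s : ℕ) : Bool :=
  let v := (Code.evaln s.unpair.2 (Denumerable.ofNat Code k) s.unpair.1).getD 0
  decide (0 < v ∧ v ≤ s)

theorem primrec_codeWitness : Primrec₂ codeWitness := by
  have hu : Primrec fun p : ℕ × ℕ => p.2.unpair := Primrec.unpair.comp .snd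
  have hv : Primrec fun p : ℕ × ℕ =>
      (Code.evaln p.2.unpair.2 (Denumerable.ofNat Code p.1) p.2.unpair.1).getD 0 :=
    Primrec.option_getD.comp
      (Code.primrec_evaln.comp (Primrec.pair (Primrec.pair (Primrec.snd.comp hu)
        ((Primrec.ofNat Code).comp .fst)) (Primrec.fst.comp hu)))
      (.const 0)
  exact ((Primrec.nat_lt.comp (.const 0) hv).and (Primrec.nat_le.comp hv .snd)).decide

/-- Every total computable function has a code `k` whose witnesses are exactly its positive
values. -/
theorem exists_codeWitness {g : ℕ → ℕ} (hg : Computable g) :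
    ∃ k, (∀ s, codeWitness k s = true → 0 < g s.unpair.1 ∧ g s.unpair.1 ≤ s) ∧
      ∀ x, 0 < g x → ∃ s, s.unpair.1 = x ∧ x < s ∧ codeWitness k s = true := by
  obtain ⟨c, hc⟩ := Code.exists_code.1 (Partrec.nat_iff.1 hg)
  refine ⟨Encodable.encode c, fun s hs => ?_, fun x hx => ?_⟩
  · simp only [codeWitness, Denumerable.ofNat_encode, decide_eq_true_eq] at hs
    cases he : Code.evaln s.unpair.2 c s.unpair.1 with
    | none => simp [he] at hs
    | some v =>
      have := Code.evaln_sound (Option.mem_def.2 he)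
      simp only [hc, PFun.coe_val, Part.mem_some_iff] at this
      simpa [he, this] using hs
  · obtain ⟨w, hw⟩ := Code.evaln_complete.1 (show g x ∈ c.eval x by simp [hc])
    let w' := max w (g x + x + 1)
    have hw' := Code.evaln_mono (le_max_left w (g x + x + 1)) hw
    have hle : w' ≤ Nat.pair x w' := Nat.right_le_pair x w'
    have hm : g x + x + 1 ≤ w' := le_max_right _ _
    refine ⟨Nat.pair x w', by simp, by omega, ?_⟩
    simp only [codeWitness, Denumerable.ofNat_encode, Nat.unpair_pair, decide_eq_true_eq]
    rw [Option.mem_def.1 hw']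
    exact ⟨hx, by simp only [Option.getD_some]; omega⟩

theorem lt_foldr_add_succ {i : ℕ} {l : List ℕ} (h : i ∈ l) :
    i < l.foldr (fun a b => a + b) 1 := by
  induction l with
  | nil => cases h
  | cons a l ih =>
    have hpos : ∀ l : List ℕ, 0 < l.foldr (fun a b => a + b) 1 := fun l => by
      induction l with
      | nil => exact Nat.one_pos
      | cons a l ih => exact Nat.lt_add_left a ih
    rcases List.mem_cons.1 h with rfl | h
    · exact Nat.lt_add_of_pos_right (hpos l)
    · exact Nat.lt_add_left a (ih h)

/-- The requirement attached to a computable set `Y` and a computable function `d`. -/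
theorem exists_codeWitness_mem {Y : Set ℕ} {d : ℕ → List ℕ} (hY : ComputablePred (· ∈ Y))
    (hd : Computable d) :
    ∃ k, (∀ s, codeWitness k s = true → s.unpair.1 ∈ Y ∧ ∀ i ∈ d s.unpair.1, i < s) ∧
      ∀ x ∈ Y, ∃ s, s.unpair.1 = x ∧ x < s ∧ codeWitness k s = true := by
  obtain ⟨_, hY⟩ := hY
  have hsum : Primrec fun l : List ℕ => l.foldr (fun a b => a + b) 1 :=
    Primrec.list_foldr .id (.const 1)
      (Primrec.nat_add.comp (Primrec.fst.comp .snd) (Primrec.snd.comp .snd)).to₂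
  have hg : Computable fun x => bif decide (x ∈ Y) then
      (d x).foldr (fun a b => a + b) 1 + 1 else 0 :=
    Computable.cond hY (Computable.succ.comp (hsum.to_comp.comp hd)) (.const 0)
  obtain ⟨k, hk₁, hk₂⟩ := exists_codeWitness hg
  refine ⟨k, fun s hs => ?_, fun x hx => hk₂ x (by simp [hx])⟩
  have h := hk₁ s hs
  by_cases hx : s.unpair.1 ∈ Y
  · simp only [hx, decide_true, cond_true] at h
    exact ⟨hx, fun i hi => (lt_foldr_add_succ hi).trans h.2⟩
  · simp [hx] at h

end FiniteInjury

open FiniteInjury in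
/-- There is an infinite computable effectively Hausdorff CSC space which is discrete but
has no infinite computable effectively discrete subspace: there are computable `V` and `e`
such that (i) for distinct `x, y`, `e x y = (m, n)` gives disjoint basic sets `V_m ∋ x`,
`V_n ∋ y`; (ii) every singleton is open in the generated topology; and (iii) there is no
infinite computable `Y ⊆ ℕ` with a computable `d : ℕ → List ℕ` assigning to each `x ∈ Y` a
nonempty finite list of indices with `(⋂_{i ∈ d x} V_i) ∩ Y = {x}`. -/
theorem effectively_hausdorff_discrete_no_effectively_discrete_subspace :
    ∃ (V : ℕ → ℕ → Bool) (e : ℕ → ℕ → ℕ × ℕ),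
      Computable₂ V ∧ Computable₂ e ∧
      (∀ x y : ℕ, x ≠ y →
        V (e x y).1 x = true ∧ V (e x y).2 y = true ∧
        {z | V (e x y).1 z = true} ∩ {z | V (e x y).2 z = true} = ∅) ∧
      (∀ x : ℕ, @IsOpen ℕ (cscTop V) {x}) ∧
      ¬ ∃ (Y : Set ℕ) (d : ℕ → List ℕ),
        Y.Infinite ∧ ComputablePred (· ∈ Y) ∧ Computable d ∧
        ∀ x ∈ Y, d x ≠ [] ∧ {z | ∀ i ∈ d x, V i z = true} ∩ Y = {x} := by
  refine ⟨basic codeWitness, fun x y => (Nat.pair x y, Nat.pair y x),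
    (primrec_basic primrec_codeWitness).to_comp,
    (Primrec.pair Primrec₂.natPair (Primrec₂.natPair.comp .snd .fst)).to_comp,
    fun x y hxy => ⟨basic_left x y, basic_left y x, ?_⟩, fun x => ?_, ?_⟩
  · exact Set.eq_empty_iff_forall_notMem.2 fun z hz => basic_disjoint hxy z hz
  · exact TopologicalSpace.isOpen_generateFrom_of_mem (exists_basic_eq_singleton x)
  · rintro ⟨Y, d, hinf, hY, hd, h⟩
    obtain ⟨k, hsound, hcomplete⟩ := exists_codeWitness_mem hY hd
    obtain ⟨s, hs, y, hy, hne, hcopy⟩ :=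
      exists_copy hinf k hcomplete
    obtain ⟨hx, hlt⟩ := hsound s hs
    have heq := (h _ hx).2
    have hmem := (heq.ge rfl).1
    exact hne (heq.le ⟨fun i hi => (hcopy i (hlt i hi)).trans (hmem i hi), hy⟩)
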